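/- (Mercer's theorem.) Let K : [0,1] × [0,1] → ℝ be continuous and symmetric, i.e. K(x,y) = K(y,x) for all x, y ∈ [0,1]. Let (fₖ)ₖ∈ℕ be a sequence of continuous functions on [0,1] whose equivalence classes form a Hilbert basis of L²([0,1]; ℝ), and let (λₖ)ₖ∈ℕ be nonnegative real numbers such that ∫₀¹ K(x,y) fₖ(y) dy = λₖ fₖ(x) for every k and every x ∈ [0,1]. Then K(x,y) = Σₖ λₖ fₖ(x) fₖ(y) for all x, y ∈ [0,1], and the series converges uniformly on [0,1] × [0,1]. -/

import Mathlib

open Real Set MeasureTheory Filter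

/-- The inner product of a function with `f`, when `u` is represented by `f` and `v` by `g`. -/
lemma inner_toLp_eq_setIntegral {s : Set ℝ} {u : Lp ℝ 2 (volume.restrict s)} {f g : ℝ → ℝ}
    (hu : (u : ℝ → ℝ) =ᵐ[volume.restrict s] f) (hg : MemLp g 2 (volume.restrict s)) :
    inner ℝ u (hg.toLp g) = ∫ x in s, f x * g x := by
  rw [L2.inner_def]
  refine integral_congr_ae ?_
  filter_upwards [hu, hg.coeFn_toLp] with x hx hx'
  rw [hx, hx', real_inner_eq_re_inner, RCLike.inner_apply]
  simp [mul_comm]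

lemma memLp_two_restrict_Icc {g : ℝ → ℝ} (hg : Continuous g) (a b : ℝ) :
    MemLp g 2 (volume.restrict (Icc a b)) := by
  obtain ⟨C, hC⟩ := isCompact_Icc.exists_bound_of_continuousOn (s := Icc a b) hg.continuousOn
  refine MemLp.of_bound hg.aestronglyMeasurable C ?_
  filter_upwards [ae_restrict_mem measurableSet_Icc] with x hx using hC x hx

/-- The quadratic form of the kernel, evaluated at the indicator function of an interval. -/
lemma hasSum_setIntegral_kernel {K : ℝ → ℝ → ℝ} (hK : Continuous fun p : ℝ × ℝ => K p.1 p.2)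
    (hsymm : ∀ x y, K x y = K y x) {f : ℕ → ℝ → ℝ} (hf : ∀ k, Continuous (f k))
    (b : HilbertBasis ℕ ℝ (Lp ℝ 2 (volume.restrict (Icc (0 : ℝ) 1))))
    (hb : ∀ k, (b k : ℝ → ℝ) =ᵐ[volume.restrict (Icc (0 : ℝ) 1)] f k)
    {lam : ℕ → ℝ}
    (heig : ∀ k, ∀ x ∈ Icc (0 : ℝ) 1, ∫ y in Icc (0 : ℝ) 1, K x y * f k y = lam k * f k x)
    {c d : ℝ} (hcd : Icc c d ⊆ Icc 0 1) :
    HasSum (fun k => lam k * (∫ y in Icc c d, f k y) ^ 2)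
      (∫ x in Icc c d, ∫ y in Icc c d, K x y) := by
  have hTc : Continuous fun x => ∫ y in Icc c d, K x y :=
    continuous_parametric_integral_of_continuous hK isCompact_Icc
  have hT := memLp_two_restrict_Icc hTc 0 1
  have hres : (volume.restrict (Icc (0 : ℝ) 1)).restrict (Icc c d) = volume.restrict (Icc c d) := by
    rw [Measure.restrict_restrict measurableSet_Icc, inter_eq_left.2 hcd]
  have hfin : (volume.restrict (Icc (0 : ℝ) 1)) (Icc c d) ≠ ⊤ := measure_ne_top _ _
  have hsum := b.hasSum_inner_mul_inner
    (indicatorConstLp 2 measurableSet_Icc hfin (1 : ℝ)) (hT.toLp _)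
  have h1 : ∀ k, inner ℝ (indicatorConstLp 2 measurableSet_Icc hfin (1 : ℝ)) (b k) =
      ∫ y in Icc c d, f k y := fun k => by
    rw [L2.inner_indicatorConstLp_one, hres]
    exact integral_congr_ae (ae_restrict_of_ae_restrict_of_subset hcd (hb k))
  have h2 : ∀ k, inner ℝ (b k) (hT.toLp _) = lam k * ∫ y in Icc c d, f k y := fun k => by
    rw [inner_toLp_eq_setIntegral (hb k)]
    simp_rw [← integral_const_mul]
    rw [integral_integral_swap]
    · refine setIntegral_congr_fun measurableSet_Icc fun y hy => ?_
      rw [← heig k y (hcd hy)]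
      exact integral_congr_ae (.of_forall fun x => by simp only [hsymm x y, mul_comm])
    · rw [Measure.prod_restrict]
      refine ContinuousOn.integrableOn_compact (isCompact_Icc.prod isCompact_Icc) ?_
      have := hf k
      unfold Function.uncurry
      fun_prop
  have h3 : inner ℝ (indicatorConstLp 2 measurableSet_Icc hfin (1 : ℝ)) (hT.toLp _) =
      ∫ x in Icc c d, ∫ y in Icc c d, K x y := by
    rw [L2.inner_indicatorConstLp_one, hres]
    exact integral_congr_ae (ae_restrict_of_ae_restrict_of_subset hcd hT.coeFn_toLp)
  rw [h3] at hsum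
  simp_rw [h1, h2] at hsum
  exact hsum.congr_fun fun k => by ring

/-- A continuous function on the square whose integrals over all small squares centred on the
diagonal are nonnegative is nonnegative on the diagonal. -/
lemma diag_nonneg_of_setIntegral_nonneg {R : ℝ × ℝ → ℝ} (hR : Continuous R)
    (h : ∀ c d, Icc c d ⊆ Icc (0 : ℝ) 1 → 0 ≤ ∫ p in Icc c d ×ˢ Icc c d, R p)
    {x : ℝ} (hx : x ∈ Icc (0 : ℝ) 1) : 0 ≤ R (x, x) := by
  by_contra! hneg
  obtain ⟨δ, hδ, hball⟩ := Metric.continuousAt_iff.1 (hR.continuousAt (x := (x, x))) (-R (x, x) / 2) (by linarith)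
  set c := max 0 (x - δ / 2)
  set d := min 1 (x + δ / 2)
  have hcx : x - δ / 2 ≤ c := le_max_right _ _
  have hdx : d ≤ x + δ / 2 := min_le_right _ _
  have hcd : c < d := by
    have := hx.1; have := hx.2
    rw [lt_min_iff, max_lt_iff, max_lt_iff]
    refine ⟨⟨?_, ?_⟩, ?_, ?_⟩ <;> linarith
  have hR' : ∀ p ∈ Icc c d ×ˢ Icc c d, R p ≤ R (x, x) / 2 := by
    rintro ⟨y, z⟩ ⟨hy, hz⟩
    have hlt := @hball (y, z) (by
      rw [Prod.dist_eq, max_lt_iff, Real.dist_eq, Real.dist_eq, abs_lt, abs_lt]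
      simp only [mem_Icc] at hy hz
      refine ⟨⟨?_, ?_⟩, ?_, ?_⟩ <;> linarith)
    rw [Real.dist_eq, abs_lt] at hlt
    linarith
  have hcomp : IsCompact (Icc c d ×ˢ Icc c d) := isCompact_Icc.prod isCompact_Icc
  have hle := setIntegral_mono_on (hR.continuousOn.integrableOn_compact (μ := volume) hcomp)
    (integrableOn_const hcomp.measure_lt_top.ne) hcomp.measurableSet hR'
  have hpos : 0 < (volume : Measure (ℝ × ℝ)).real (Icc c d ×ˢ Icc c d) := by
    rw [Measure.volume_eq_prod, measureReal_prod_prod, Real.volume_real_Icc_of_le hcd.le]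
    have := sub_pos.2 hcd
    positivity
  rw [setIntegral_const, smul_eq_mul] at hle
  have := h c d (Icc_subset_Icc (le_max_left _ _) (min_le_left _ _))
  nlinarith

lemma sum_mul_sq_le_kernel_diag {K : ℝ → ℝ → ℝ} (hK : Continuous fun p : ℝ × ℝ => K p.1 p.2)
    {f : ℕ → ℝ → ℝ} (hf : ∀ k, Continuous (f k)) {lam : ℕ → ℝ} (hlam : ∀ k, 0 ≤ lam k)
    (hsum : ∀ c d, Icc c d ⊆ Icc (0 : ℝ) 1 → HasSum (fun k => lam k * (∫ y in Icc c d, f k y) ^ 2)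
      (∫ x in Icc c d, ∫ y in Icc c d, K x y))
    (s : Finset ℕ) {x : ℝ} (hx : x ∈ Icc (0 : ℝ) 1) :
    ∑ k ∈ s, lam k * f k x * f k x ≤ K x x := by
  have hsc : Continuous fun p : ℝ × ℝ => ∑ k ∈ s, lam k * (f k p.1 * f k p.2) :=
    continuous_finsetSum _ fun k _ => by have := hf k; fun_prop
  have key := diag_nonneg_of_setIntegral_nonneg
    (R := fun p => K p.1 p.2 - ∑ k ∈ s, lam k * (f k p.1 * f k p.2)) (hK.sub hsc) ?_ hx
  · simpa [mul_assoc] using key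
  intro c d hcd
  have hcomp : IsCompact (Icc c d ×ˢ Icc c d) := isCompact_Icc.prod isCompact_Icc
  have hKi := hK.continuousOn.integrableOn_compact (μ := volume) hcomp
  have hfi : ∀ k ∈ s, IntegrableOn (fun p : ℝ × ℝ => lam k * (f k p.1 * f k p.2))
      (Icc c d ×ˢ Icc c d) := fun k _ => by
    have := hf k
    exact (by fun_prop : Continuous _).continuousOn.integrableOn_compact hcomp
  rw [integral_sub hKi (integrable_finsetSum _ hfi), integral_finsetSum _ hfi]
  simp_rw [integral_const_mul, Measure.volume_eq_prod, setIntegral_prod_mul]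
  rw [setIntegral_prod _ (by rwa [← Measure.volume_eq_prod]), sub_nonneg]
  simp_rw [← pow_two]
  exact sum_le_hasSum s (fun k _ => mul_nonneg (hlam k) (sq_nonneg _)) (hsum c d hcd)

/-- Cauchy–Schwarz for series: if the partial sums of `∑ w k * u k ^ 2` are uniformly Cauchy and
those of `∑ w k * v k ^ 2` are uniformly bounded, then those of `∑ w k * u k * v k` are uniformly
Cauchy. -/
lemma uniformCauchySeqOn_sum_mul {α : Type*} {s : Set α} {w : ℕ → ℝ} (hw : ∀ k, 0 ≤ w k)
    {u v : ℕ → α → ℝ} {M : ℝ}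
    (hu : UniformCauchySeqOn (fun n p => ∑ k ∈ Finset.range n, w k * u k p * u k p) atTop s)
    (hv : ∀ (t : Finset ℕ), ∀ p ∈ s, ∑ k ∈ t, w k * v k p * v k p ≤ M) :
    UniformCauchySeqOn (fun n p => ∑ k ∈ Finset.range n, w k * u k p * v k p) atTop s := by
  rw [Metric.uniformCauchySeqOn_iff] at hu ⊢
  intro ε hε
  obtain ⟨N, hN⟩ := hu (ε ^ 2 / (|M| + 1)) (by positivity)
  have main : ∀ m ≥ N, ∀ n ≥ m, ∀ p ∈ s, dist (∑ k ∈ Finset.range n, w k * u k p * v k p)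
      (∑ k ∈ Finset.range m, w k * u k p * v k p) < ε := by
    intro m hm n hn p hp
    have h1 := hN n (hm.le.trans hn) m hm p hp
    rw [Real.dist_eq, ← Finset.sum_Ico_eq_sub _ hn] at h1 ⊢
    have h2 := hv (Finset.Ico m n) p hp
    have hnn : ∀ a : ℕ → α → ℝ, ∀ k ∈ Finset.Ico m n, 0 ≤ w k * a k p * a k p := fun a k _ => by
      rw [mul_assoc]; exact mul_nonneg (hw k) (mul_self_nonneg _)
    have h3 := Finset.sum_sq_le_sum_mul_sum_of_sq_le_mul (Finset.Ico m n)
      (r := fun k => w k * u k p * v k p) (hnn u) (hnn v) (fun k _ => le_of_eq (by ring))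
    refine abs_lt_of_sq_lt_sq ?_ hε.le
    have h4 := (le_abs_self _).trans_lt h1
    rw [lt_div_iff₀ (by positivity)] at h4
    refine h3.trans_lt (lt_of_le_of_lt ?_ h4)
    exact mul_le_mul_of_nonneg_left (by linarith [le_abs_self M]) (Finset.sum_nonneg (hnn u))
  refine ⟨N, fun m hm n hn p hp => ?_⟩
  rcases le_total m n with h | h
  · rw [dist_comm]; exact main m hm n h p hp
  · exact main n hn m h p hp

/-- Mercer's theorem for a kernel and eigenfunctions that are continuous on the whole space. -/
lemma mercer_of_continuous {K : ℝ → ℝ → ℝ} (hK : Continuous fun p : ℝ × ℝ => K p.1 p.2)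
    (hsymm : ∀ x y, K x y = K y x) {f : ℕ → ℝ → ℝ} (hf : ∀ k, Continuous (f k))
    (b : HilbertBasis ℕ ℝ (Lp ℝ 2 (volume.restrict (Icc (0 : ℝ) 1))))
    (hb : ∀ k, (b k : ℝ → ℝ) =ᵐ[volume.restrict (Icc (0 : ℝ) 1)] f k)
    {lam : ℕ → ℝ} (hlam : ∀ k, 0 ≤ lam k)
    (heig : ∀ k, ∀ x ∈ Icc (0 : ℝ) 1, ∫ y in Icc (0 : ℝ) 1, K x y * f k y = lam k * f k x) :
    (∀ x ∈ Icc (0 : ℝ) 1, ∀ y ∈ Icc (0 : ℝ) 1,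
        HasSum (fun k => lam k * f k x * f k y) (K x y)) ∧
    TendstoUniformlyOn
      (fun N (p : ℝ × ℝ) => ∑ k ∈ Finset.range N, lam k * f k p.1 * f k p.2)
      (fun p => K p.1 p.2) atTop (Icc 0 1 ×ˢ Icc 0 1) := by
  have hdiag := fun s {x} hx => sum_mul_sq_le_kernel_diag hK hf hlam
    (fun c d hcd => hasSum_setIntegral_kernel hK hsymm hf b hb heig hcd) s (x := x) hx
  have hKd : Continuous fun x => K x x := hK.comp (continuous_id.prodMk continuous_id)
  obtain ⟨M, hM⟩ := isCompact_Icc.exists_bound_of_continuousOn (s := Icc (0 : ℝ) 1)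
    hKd.continuousOn
  have hbound : ∀ (t : Finset ℕ), ∀ x ∈ Icc (0 : ℝ) 1, ∑ k ∈ t, lam k * f k x * f k x ≤ M :=
    fun t x hx => (hdiag t hx).trans ((le_abs_self _).trans (hM x hx))
  have hnn : ∀ x k, 0 ≤ lam k * f k x * f k x := fun x k => by
    rw [mul_assoc]; exact mul_nonneg (hlam k) (mul_self_nonneg _)
  have hsummable : ∀ x ∈ Icc (0 : ℝ) 1, Summable fun k => lam k * f k x * f k x := fun x hx =>
    summable_of_sum_le (hnn x) (fun t => hbound t x hx)
  have hsummable' : ∀ x ∈ Icc (0 : ℝ) 1, ∀ y ∈ Icc (0 : ℝ) 1,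
      Summable fun k => lam k * f k x * f k y := fun x hx y hy => by
    refine Summable.of_norm_bounded ((hsummable x hx).add (hsummable y hy)) fun k => ?_
    rw [Real.norm_eq_abs, mul_assoc, abs_mul, abs_of_nonneg (hlam k), mul_assoc, mul_assoc,
      ← mul_add]
    refine mul_le_mul_of_nonneg_left (abs_le.2 ⟨?_, ?_⟩) (hlam k) <;>
      nlinarith [sq_nonneg (f k x + f k y), sq_nonneg (f k x - f k y),
        sq_nonneg (f k x), sq_nonneg (f k y)]
  have hpt : ∀ x ∈ Icc (0 : ℝ) 1, ∀ y ∈ Icc (0 : ℝ) 1,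
      HasSum (fun k => lam k * f k x * f k y) (K x y) := by
    intro x hx
    have hcauchy : UniformCauchySeqOn
        (fun n (y : ℝ) => ∑ k ∈ Finset.range n, lam k * f k x * f k y) atTop (Icc 0 1) := by
      refine uniformCauchySeqOn_sum_mul hlam (u := fun k _ => f k x) (M := M) ?_ hbound
      have := (hsummable x hx).hasSum.tendsto_sum_nat.cauchySeq
      rw [Metric.cauchySeq_iff] at this
      rw [Metric.uniformCauchySeqOn_iff]
      exact fun ε hε => (this ε hε).imp fun N hN m hm n hn _ _ => hN m hm n hn
    have hS : ContinuousOn (fun y => ∑' k, lam k * f k x * f k y) (Icc 0 1) := by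
      refine (hcauchy.tendstoUniformlyOn_of_tendsto fun y hy =>
        (hsummable' x hx y hy).hasSum.tendsto_sum_nat).continuousOn (.of_forall fun n => ?_)
      exact (continuous_finsetSum _ fun k _ => continuous_const.mul (hf k)).continuousOn
    have hKx : Continuous (K x) := hK.comp (continuous_const.prodMk continuous_id)
    have hKL := memLp_two_restrict_Icc hKx 0 1
    have hcoef : ∀ k, inner ℝ (b k) (hKL.toLp _) = lam k * f k x := fun k => by
      rw [inner_toLp_eq_setIntegral (hb k), ← heig k x hx]
      simp_rw [mul_comm]
    have hlim := (b.hasSum_repr (hKL.toLp _)).tendsto_sum_nat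
    simp_rw [b.repr_apply_apply, hcoef] at hlim
    obtain ⟨ns, hns, hae⟩ := (tendstoInMeasure_of_tendsto_Lp hlim).exists_seq_tendsto_ae
    have hsums : ∀ n, (((∑ k ∈ Finset.range n, (lam k * f k x) • b k :
        Lp ℝ 2 (volume.restrict (Icc (0 : ℝ) 1)))) : ℝ → ℝ) =ᵐ[volume.restrict (Icc (0 : ℝ) 1)]
        fun y => ∑ k ∈ Finset.range n, lam k * f k x * f k y := fun n => by
      have hterm : ∀ᵐ y ∂volume.restrict (Icc (0 : ℝ) 1), ∀ k,
          ((lam k * f k x) • b k : Lp ℝ 2 (volume.restrict (Icc (0 : ℝ) 1))) y =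
            lam k * f k x * f k y := by
        rw [ae_all_iff]
        intro k
        filter_upwards [Lp.coeFn_smul (lam k * f k x) (b k), hb k] with y h1 h2
        rw [h1, Pi.smul_apply, h2, smul_eq_mul]
      filter_upwards [Lp.coeFn_fun_finsetSum (Finset.range n) fun k => (lam k * f k x) • b k,
        hterm] with y h1 h2
      rw [h1]
      exact Finset.sum_congr rfl fun k _ => h2 k
    have heq : (K x) =ᵐ[volume.restrict (Icc (0 : ℝ) 1)]
        fun y => ∑' k, lam k * f k x * f k y := by
      filter_upwards [hae, ae_all_iff.2 hsums, hKL.coeFn_toLp,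
        ae_restrict_mem measurableSet_Icc] with y h1 h2 h3 hy
      simp_rw [h2, h3] at h1
      exact tendsto_nhds_unique h1
        ((hsummable' x hx y hy).hasSum.tendsto_sum_nat.comp hns.tendsto_atTop)
    intro y hy
    have := Measure.eqOn_Icc_of_ae_eq volume zero_ne_one heq hKx.continuousOn hS hy
    rw [this]
    exact (hsummable' x hx y hy).hasSum
  refine ⟨hpt, ?_⟩
  have hdini : TendstoUniformlyOn (fun n x => ∑ k ∈ Finset.range n, lam k * f k x * f k x)
      (fun x => K x x) atTop (Icc 0 1) := by
    refine Monotone.tendstoUniformlyOn_of_forall_tendsto isCompact_Icc (fun n => ?_)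
      (fun x _ => ?_) hKd.continuousOn fun x hx => (hpt x hx x hx).tendsto_sum_nat
    · exact (continuous_finsetSum _ fun k _ =>
        (continuous_const.mul (hf k)).mul (hf k)).continuousOn
    · exact fun m n hmn => Finset.sum_le_sum_of_subset_of_nonneg
        (Finset.range_mono hmn) fun k _ _ => hnn x k
  refine UniformCauchySeqOn.tendstoUniformlyOn_of_tendsto ?_
    fun p hp => (hpt p.1 hp.1 p.2 hp.2).tendsto_sum_nat
  refine uniformCauchySeqOn_sum_mul hlam (u := fun k (p : ℝ × ℝ) => f k p.1)
    (v := fun k p => f k p.2) (M := M) ?_ fun t p hp => hbound t p.2 hp.2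
  have hC := hdini.uniformCauchySeqOn
  rw [Metric.uniformCauchySeqOn_iff] at hC ⊢
  exact fun ε hε => (hC ε hε).imp fun N hN m hm n hn p hp => hN m hm n hn p.1 hp.1

/-- Mercer's theorem: for a continuous symmetric kernel `K` on `[0,1] × [0,1]` whose continuous
eigenfunctions `f k` (with nonnegative eigenvalues `lam k`) form a Hilbert basis of `L²([0,1])`,
one has `K x y = ∑ k, lam k * f k x * f k y`, uniformly on `[0,1] × [0,1]`. -/
theorem mercer (K : ℝ → ℝ → ℝ)
    (hK : ContinuousOn (fun p : ℝ × ℝ => K p.1 p.2) (Icc 0 1 ×ˢ Icc 0 1))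
    (hsymm : ∀ x ∈ Icc (0:ℝ) 1, ∀ y ∈ Icc (0:ℝ) 1, K x y = K y x)
    (f : ℕ → ℝ → ℝ) (hf : ∀ k, ContinuousOn (f k) (Icc 0 1))
    (b : HilbertBasis ℕ ℝ (Lp ℝ 2 (volume.restrict (Icc (0:ℝ) 1))))
    (hb : ∀ k, (b k : ℝ → ℝ) =ᵐ[volume.restrict (Icc (0:ℝ) 1)] f k)
    (lam : ℕ → ℝ) (hlam : ∀ k, 0 ≤ lam k)
    (heig : ∀ k, ∀ x ∈ Icc (0:ℝ) 1, (∫ y in (0:ℝ)..1, K x y * f k y) = lam k * f k x) :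
    (∀ x ∈ Icc (0:ℝ) 1, ∀ y ∈ Icc (0:ℝ) 1,
        HasSum (fun k => lam k * f k x * f k y) (K x y)) ∧
    TendstoUniformlyOn
      (fun N (p : ℝ × ℝ) => ∑ k ∈ Finset.range N, lam k * f k p.1 * f k p.2)
      (fun p => K p.1 p.2) atTop (Icc 0 1 ×ˢ Icc 0 1) := by
  have h01 : (0 : ℝ) ≤ 1 := zero_le_one
  set q : ℝ → ℝ := fun x => projIcc 0 1 h01 x
  have hq : Continuous q := continuous_subtype_val.comp continuous_projIcc
  have hmem : ∀ x, q x ∈ Icc (0 : ℝ) 1 := fun x => (projIcc 0 1 h01 x).2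
  have hid : ∀ x ∈ Icc (0 : ℝ) 1, q x = x := fun x hx => by simp [q, projIcc_of_mem h01 hx]
  obtain ⟨h1, h2⟩ := mercer_of_continuous (K := fun x y => K (q x) (q y))
    (f := fun k x => f k (q x)) (lam := lam)
    (hK.comp_continuous ((hq.comp continuous_fst).prodMk (hq.comp continuous_snd))
      fun p => ⟨hmem p.1, hmem p.2⟩)
    (fun x y => hsymm _ (hmem x) _ (hmem y))
    (fun k => (hf k).comp_continuous hq hmem) b
    (fun k => by
      filter_upwards [hb k, ae_restrict_mem measurableSet_Icc] with x hx hx'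
      rw [hx, hid x hx'])
    hlam
    (fun k x hx => by
      rw [hid x hx, ← heig k x hx, intervalIntegral.integral_of_le h01,
        ← integral_Icc_eq_integral_Ioc]
      refine setIntegral_congr_fun measurableSet_Icc fun y hy => ?_
      simp only [hid y hy])
  refine ⟨fun x hx y hy => by simpa only [hid x hx, hid y hy] using h1 x hx y hy, ?_⟩
  refine (h2.congr (.of_forall fun n p hp => ?_)).congr_right fun p hp => ?_
  · simp only [hid p.1 hp.1, hid p.2 hp.2]
  · simp only [hid p.1 hp.1, hid p.2 hp.2]
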